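/- Let ω > 0, s ∈ ℂ, and for 0 < ε < min{1, 1/ω} define G_s(ω) = ∫_{-ε+iℝ} (-t)^{s-1}/((e^{2πit}-1)(e^{-2πiωt}-1)) dt. Then the three-term relation G_s(ω) = G_s(ω+1) + (ω+1)^{-s} · G_s(ω/(ω+1)) holds. -/

import Mathlib

open MeasureTheory Complex

/-- The contour integral `G_s(ω) = ∫_{-ε+iℝ} (-t)^{s-1}/((e^{2πit}-1)(e^{-2πiωt}-1)) dt`,
parametrized by `t = -ε + iu`, `u ∈ ℝ`; `(-t)^{s-1}` is the principal branch. -/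
noncomputable def Gcont (s : ℂ) (ω ε : ℝ) : ℂ :=
  ∫ u : ℝ,
    Complex.I * ((-((-ε : ℂ) + u * Complex.I)) ^ (s - 1) /
      ((Complex.exp (2 * Real.pi * Complex.I * ((-ε : ℂ) + u * Complex.I)) - 1) *
       (Complex.exp (-(2 * Real.pi * Complex.I * ω * ((-ε : ℂ) + u * Complex.I))) - 1)))

open Filter Topology

/-- `exp (-c |u|)` is integrable on the real line. -/
lemma integrable_exp_neg_const_mul_abs {c : ℝ} (hc : 0 < c) :
    Integrable fun u : ℝ => Real.exp (-c * |u|) := by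
  rw [← integrableOn_univ, ← Set.Iic_union_Ioi (a := (0 : ℝ))]
  refine IntegrableOn.union ?_ ?_
  · refine (integrableOn_exp_mul_Iic hc 0).congr_fun (fun u hu => ?_) measurableSet_Iic
    simp [abs_of_nonpos (Set.mem_Iic.mp hu)]
  · refine (integrableOn_exp_mul_Ioi (neg_lt_zero.mpr hc) 0).congr_fun (fun u hu => ?_)
      measurableSet_Ioi
    simp [abs_of_pos (Set.mem_Ioi.mp hu)]

/-- A continuous function on a vertical line with exponential decay is integrable there. -/
lemma integrable_vertical_of_exp_decay {f : ℂ → ℂ} {S : Set ℂ} {a C c : ℝ} (hc : 0 < c)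
    (hf : ContinuousOn f S) (hS : ∀ u : ℝ, (a : ℂ) + u * I ∈ S)
    (hb : ∀ u : ℝ, ‖f (a + u * I)‖ ≤ C * Real.exp (-c * |u|)) :
    Integrable fun u : ℝ => f (a + u * I) := by
  refine ((integrable_exp_neg_const_mul_abs hc).const_mul C).mono' ?_ (.of_forall hb)
  exact (hf.comp_continuous (by fun_prop) hS).aestronglyMeasurable

/-- Cauchy's theorem for a vertical strip: the integral of a holomorphic function with uniform
exponential decay is the same along both boundary lines. -/
lemma integral_vertical_eq_of_exp_decay {f : ℂ → ℂ} {a b C c : ℝ} (hab : a ≤ b) (hc : 0 < c)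
    (hf : DifferentiableOn ℂ f (re ⁻¹' Set.Icc a b))
    (hb : ∀ x ∈ Set.Icc a b, ∀ u : ℝ, ‖f (x + u * I)‖ ≤ C * Real.exp (-c * |u|)) :
    ∫ u : ℝ, f (a + u * I) = ∫ u : ℝ, f (b + u * I) := by
  have line : ∀ x ∈ Set.Icc a b, Tendsto (fun T : ℝ => ∫ u in (-T)..T, f (x + u * I)) atTop
      (𝓝 (∫ u : ℝ, f (x + u * I))) := fun x hx =>
    intervalIntegral_tendsto_integral
      (integrable_vertical_of_exp_decay hc hf.continuousOn (fun u => by simpa using hx) (hb x hx))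
      tendsto_neg_atTop_atBot tendsto_id
  have decay : Tendsto (fun T : ℝ => C * Real.exp (-c * |T|) * |b - a|) atTop (𝓝 0) := by
    have : Tendsto (fun T : ℝ => Real.exp (-c * |T|)) atTop (𝓝 0) :=
      Real.tendsto_exp_atBot.comp
        ((tendsto_const_mul_atBot_of_neg (neg_lt_zero.mpr hc)).mpr tendsto_abs_atTop_atTop)
    simpa using (this.const_mul C).mul_const |b - a|
  have side : ∀ T : ℝ, ‖∫ x in a..b, f (x + T * I)‖ ≤ C * Real.exp (-c * |T|) * |b - a| :=
    fun T => intervalIntegral.norm_integral_le_of_norm_le_const fun x hx =>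
      hb x (Set.Ioc_subset_Icc_self (by rwa [Set.uIoc_of_le hab] at hx)) T
  have top : Tendsto (fun T : ℝ => ∫ x in a..b, f (x + T * I)) atTop (𝓝 0) :=
    squeeze_zero_norm side decay
  have bottom : Tendsto (fun T : ℝ => ∫ x in a..b, f (x + (-T : ℝ) * I)) atTop (𝓝 0) :=
    squeeze_zero_norm (fun T => by simpa using side (-T)) decay
  have rect : ∀ T : ℝ, (∫ x in a..b, f (x + (-T : ℝ) * I)) - (∫ x in a..b, f (x + T * I)) +
      I • (∫ u in (-T)..T, f (b + u * I)) - I • (∫ u in (-T)..T, f (a + u * I)) = 0 := by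
    intro T
    have := integral_boundary_rect_eq_zero_of_differentiableOn f ⟨a, -T⟩ ⟨b, T⟩
      (hf.mono fun z hz => by simpa [Set.uIcc_of_le hab] using hz.1)
    simpa using this
  have lim := ((bottom.sub top).add ((line b ⟨hab, le_rfl⟩).const_smul I)).sub
    ((line a ⟨le_rfl, hab⟩).const_smul I)
  simp only [rect] at lim
  have := tendsto_nhds_unique lim tendsto_const_nhds
  simp only [sub_zero, zero_add, smul_eq_mul, ← mul_sub, mul_eq_zero, I_ne_zero, false_or] at this
  exact (sub_eq_zero.mp this).symm

/-- On a half-plane `a ≤ re z` with `a > 0`, powers grow slower than any exponential. -/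
lemma exists_norm_cpow_le_exp (w : ℂ) {a δ : ℝ} (ha : 0 < a) (hδ : 0 < δ) :
    ∃ C, 0 ≤ C ∧ ∀ z : ℂ, a ≤ z.re → ‖z ^ w‖ ≤ C * Real.exp (δ * ‖z‖) := by
  obtain ⟨n, hn⟩ := exists_nat_ge w.re
  refine ⟨a ^ w.re / (a * δ) ^ n * n.factorial * Real.exp (Real.pi * |w.im|), by positivity,
    fun z hz => ?_⟩
  have haz : a ≤ ‖z‖ := hz.trans (re_le_norm z)
  have harg : -(arg z * w.im) ≤ Real.pi * |w.im| :=
    (neg_le_abs _).trans <| by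
      rw [abs_mul]; exact mul_le_mul_of_nonneg_right (abs_arg_le_pi z) (abs_nonneg _)
  have hpow : ‖z‖ ^ w.re ≤
      a ^ w.re / (a * δ) ^ n * n.factorial * Real.exp (δ * ‖z‖) := by
    have h1 : (‖z‖ / a) ^ w.re ≤ (‖z‖ / a) ^ n := by
      rw [← Real.rpow_natCast]
      exact Real.rpow_le_rpow_of_exponent_le ((one_le_div ha).mpr haz) hn
    have h2 : (δ * ‖z‖) ^ n ≤ n.factorial * Real.exp (δ * ‖z‖) := by
      have := Real.pow_div_factorial_le_exp (δ * ‖z‖) (by positivity) n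
      rwa [div_le_iff₀' (by positivity)] at this
    calc ‖z‖ ^ w.re = a ^ w.re * (‖z‖ / a) ^ w.re := by
          rw [← Real.mul_rpow ha.le (by positivity), mul_div_cancel₀ _ ha.ne']
      _ ≤ a ^ w.re * (‖z‖ / a) ^ n := by gcongr
      _ = a ^ w.re / (a * δ) ^ n * (δ * ‖z‖) ^ n := by
          rw [div_pow, mul_pow, mul_pow]; field_simp
      _ ≤ a ^ w.re / (a * δ) ^ n * (n.factorial * Real.exp (δ * ‖z‖)) := by gcongr
      _ = _ := by ring
  calc ‖z ^ w‖ ≤ ‖z‖ ^ w.re * Real.exp (-(arg z * w.im)) := by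
        rw [Real.exp_neg, ← div_eq_mul_inv]; exact norm_cpow_le z w
    _ ≤ (a ^ w.re / (a * δ) ^ n * n.factorial * Real.exp (δ * ‖z‖)) *
        Real.exp (Real.pi * |w.im|) := by gcongr
    _ = _ := by ring

lemma abs_sin_half_im_mul_le_norm_exp_sub_one (w : ℂ) :
    |Real.sin (w.im / 2)| * (Real.exp w.re + 1) ≤ ‖exp w - 1‖ := by
  rw [← abs_of_pos (by positivity : 0 < Real.exp w.re + 1), ← abs_mul]
  refine abs_le_of_sq_le_sq ?_ (norm_nonneg _)
  have hcos : Real.cos w.im = 1 - 2 * Real.sin (w.im / 2) ^ 2 := by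
    have := Real.cos_two_mul' (w.im / 2)
    rw [mul_div_cancel₀ _ two_ne_zero, Real.cos_sq'] at this
    linarith
  rw [← normSq_eq_norm_sq, normSq_apply]
  simp only [sub_re, exp_re, one_re, sub_im, exp_im, one_im, sub_zero]
  have hs := Real.sin_sq_add_cos_sq w.im
  have hle := Real.sin_sq_le_one (w.im / 2)
  have key : (Real.exp w.re * Real.cos w.im - 1) * (Real.exp w.re * Real.cos w.im - 1) +
      Real.exp w.re * Real.sin w.im * (Real.exp w.re * Real.sin w.im) -
      (Real.sin (w.im / 2) * (Real.exp w.re + 1)) ^ 2 =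
      (1 - Real.sin (w.im / 2) ^ 2) * (Real.exp w.re - 1) ^ 2 := by
    linear_combination Real.exp w.re ^ 2 * hs - 2 * Real.exp w.re * hcos
  have := mul_nonneg (sub_nonneg.mpr hle) (sq_nonneg (Real.exp w.re - 1))
  linarith

lemma exists_pos_le_abs_sin {ω a b : ℝ} (hω : 0 < ω) (ha : 0 < a) (hb : ω * b < 1) :
    ∃ m > 0, ∀ x ∈ Set.Icc a b, m ≤ |Real.sin (Real.pi * (ω * x))| := by
  rcases (Set.Icc a b).eq_empty_or_nonempty with h | h
  · exact ⟨1, one_pos, by simp [h]⟩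
  obtain ⟨x₀, hx₀, hmin⟩ := isCompact_Icc.exists_isMinOn h
    (f := fun x => |Real.sin (Real.pi * (ω * x))|) (by fun_prop)
  refine ⟨_, abs_pos.mpr (Real.sin_pos_of_pos_of_lt_pi ?_ ?_).ne', fun x hx => hmin hx⟩
  · have := ha.trans_le hx₀.1
    positivity
  · have : ω * x₀ ≤ ω * b := mul_le_mul_of_nonneg_left hx₀.2 hω.le
    nlinarith [Real.pi_pos]

/-- The integrand of `Gcont` as a function of the contour variable. -/
noncomputable def gcontIntegrand (s : ℂ) (ω : ℝ) (t : ℂ) : ℂ :=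
  (-t) ^ (s - 1) / ((exp (2 * Real.pi * I * t) - 1) * (exp (-(2 * Real.pi * I * ω * t)) - 1))

lemma Gcont_eq (s : ℂ) (ω ε : ℝ) :
    Gcont s ω ε = I * ∫ u : ℝ, gcontIntegrand s ω (((-ε : ℝ) : ℂ) + u * I) := by
  rw [← integral_const_mul]
  simp [Gcont, gcontIntegrand]

lemma sin_mul_le_norm_exp_sub_one (t : ℂ) :
    |Real.sin (Real.pi * -t.re)| * (Real.exp (-(2 * Real.pi * t.im)) + 1) ≤
      ‖exp (2 * Real.pi * I * t) - 1‖ := by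
  convert abs_sin_half_im_mul_le_norm_exp_sub_one (2 * Real.pi * I * t) using 2
  · rw [mul_neg, Real.sin_neg, abs_neg]
    congr 2
    simp
    ring
  · simp

lemma sin_mul_le_norm_exp_neg_sub_one (ω : ℝ) (t : ℂ) :
    |Real.sin (Real.pi * (ω * -t.re))| * (Real.exp (2 * Real.pi * ω * t.im) + 1) ≤
      ‖exp (-(2 * Real.pi * I * ω * t)) - 1‖ := by
  convert abs_sin_half_im_mul_le_norm_exp_sub_one (-(2 * Real.pi * I * ω * t)) using 2
  · congr 2
    simp
    ring
  · simp

lemma exp_two_pi_I_mul_sub_one_ne_zero {t : ℂ} (h0 : t.re < 0) (h1 : -t.re < 1) :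
    exp (2 * Real.pi * I * t) - 1 ≠ 0 := by
  have hs : Real.sin (Real.pi * -t.re) ≠ 0 := (Real.sin_pos_of_pos_of_lt_pi
    (mul_pos Real.pi_pos (neg_pos.mpr h0)) (by nlinarith [Real.pi_pos])).ne'
  have : 0 < |Real.sin (Real.pi * -t.re)| * (Real.exp (-(2 * Real.pi * t.im)) + 1) := by
    positivity
  exact norm_pos_iff.mp (this.trans_le (sin_mul_le_norm_exp_sub_one t))

lemma exp_neg_two_pi_I_mul_sub_one_ne_zero {ω : ℝ} {t : ℂ} (hω : 0 < ω) (h0 : t.re < 0)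
    (h1 : ω * -t.re < 1) : exp (-(2 * Real.pi * I * ω * t)) - 1 ≠ 0 := by
  have hs : Real.sin (Real.pi * (ω * -t.re)) ≠ 0 := (Real.sin_pos_of_pos_of_lt_pi
    (mul_pos Real.pi_pos (mul_pos hω (neg_pos.mpr h0))) (by nlinarith [Real.pi_pos])).ne'
  have : 0 < |Real.sin (Real.pi * (ω * -t.re))| * (Real.exp (2 * Real.pi * ω * t.im) + 1) := by
    positivity
  exact norm_pos_iff.mp (this.trans_le (sin_mul_le_norm_exp_neg_sub_one ω t))

lemma differentiableOn_gcontIntegrand (s : ℂ) {ω a b : ℝ} (hω : 0 < ω) (ha : 0 < a) (hb : b < 1)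
    (hbω : ω * b < 1) :
    DifferentiableOn ℂ (gcontIntegrand s ω) (re ⁻¹' Set.Icc (-b) (-a)) := by
  intro t ht
  have h0 : t.re < 0 := by linarith [ht.2]
  have hlb : -b ≤ t.re := ht.1
  have h1 : ω * -t.re < 1 := by nlinarith
  refine DifferentiableAt.differentiableWithinAt ?_
  unfold gcontIntegrand
  refine DifferentiableAt.div ?_ (by fun_prop) (mul_ne_zero
    (exp_two_pi_I_mul_sub_one_ne_zero h0 (by linarith))
    (exp_neg_two_pi_I_mul_sub_one_ne_zero hω h0 h1))
  exact differentiableAt_id.neg.cpow_const (Or.inl (by simpa using h0))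

lemma exp_mul_abs_le_mul (ω u : ℝ) :
    Real.exp (2 * Real.pi * min 1 ω * |u|) ≤
      (Real.exp (-(2 * Real.pi * u)) + 1) * (Real.exp (2 * Real.pi * ω * u) + 1) := by
  have hpi := Real.pi_pos
  have p := Real.exp_pos (-(2 * Real.pi * u))
  have q := Real.exp_pos (2 * Real.pi * ω * u)
  rcases le_total 0 u with hu | hu
  · have : Real.exp (2 * Real.pi * min 1 ω * |u|) ≤ Real.exp (2 * Real.pi * ω * u) := by
      rw [abs_of_nonneg hu]
      gcongr
      exact min_le_right _ _
    nlinarith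
  · have : Real.exp (2 * Real.pi * min 1 ω * |u|) ≤ Real.exp (-(2 * Real.pi * u)) := by
      rw [abs_of_nonpos hu, ← mul_neg, mul_assoc, mul_assoc, mul_assoc]
      gcongr
      exact mul_le_of_le_one_left (by linarith) (min_le_left _ _)
    nlinarith

/-- Uniform exponential decay of the integrand in a closed substrip free of poles. -/
lemma exists_norm_gcontIntegrand_le (s : ℂ) {ω a b : ℝ} (hω : 0 < ω) (ha : 0 < a) (hb : b < 1)
    (hbω : ω * b < 1) :
    ∃ C c : ℝ, 0 < c ∧ ∀ x ∈ Set.Icc (-b) (-a), ∀ u : ℝ,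
      ‖gcontIntegrand s ω (x + u * I)‖ ≤ C * Real.exp (-c * |u|) := by
  have hδ : 0 < Real.pi * min 1 ω := mul_pos Real.pi_pos (lt_min one_pos hω)
  set δ := Real.pi * min 1 ω with hδ_def
  obtain ⟨C, hC, hpow⟩ := exists_norm_cpow_le_exp (s - 1) ha hδ
  obtain ⟨m, hm, hsin⟩ := exists_pos_le_abs_sin one_pos ha (by simpa using hb)
  obtain ⟨m', hm', hsin'⟩ := exists_pos_le_abs_sin hω ha hbω
  refine ⟨C * Real.exp δ / (m * m'), δ, hδ, fun x hx u => ?_⟩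
  have hx' : -x ∈ Set.Icc a b := ⟨by linarith [hx.2], by linarith [hx.1]⟩
  set t : ℂ := x + u * I with ht
  have hre : t.re = x := by simp [ht]
  have him : t.im = u := by simp [ht]
  have hnorm : ‖-t‖ ≤ 1 + |u| := by
    rw [norm_neg]
    refine (norm_le_abs_re_add_abs_im t).trans ?_
    rw [hre, him, abs_of_neg (by linarith [hx.2])]
    linarith [hx'.2]
  have hnum : ‖(-t) ^ (s - 1)‖ ≤ C * Real.exp (δ * (1 + |u|)) :=
    (hpow (-t) (by simpa [hre] using hx'.1)).trans (by gcongr)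
  have hden : m * m' * Real.exp (2 * δ * |u|) ≤
      ‖(exp (2 * Real.pi * I * t) - 1) * (exp (-(2 * Real.pi * I * ω * t)) - 1)‖ := by
    have h1 := sin_mul_le_norm_exp_sub_one t
    have h2 := sin_mul_le_norm_exp_neg_sub_one ω t
    rw [hre, him] at h1 h2
    have hs := hsin _ hx'
    rw [one_mul] at hs
    calc m * m' * Real.exp (2 * δ * |u|)
        ≤ m * m' * ((Real.exp (-(2 * Real.pi * u)) + 1) *
            (Real.exp (2 * Real.pi * ω * u) + 1)) := by
          gcongr
          rw [hδ_def, ← mul_assoc]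
          exact exp_mul_abs_le_mul ω u
      _ = (m * (Real.exp (-(2 * Real.pi * u)) + 1)) *
            (m' * (Real.exp (2 * Real.pi * ω * u) + 1)) := by ring
      _ ≤ _ := by
          rw [norm_mul]
          refine mul_le_mul (le_trans (by gcongr) h1)
            (le_trans (mul_le_mul_of_nonneg_right (hsin' _ hx') (by positivity)) h2)
            (by positivity) (norm_nonneg _)
  calc ‖gcontIntegrand s ω t‖
      ≤ C * Real.exp (δ * (1 + |u|)) / (m * m' * Real.exp (2 * δ * |u|)) := by
        rw [gcontIntegrand, norm_div]
        exact div_le_div₀ (by positivity) hnum (by positivity) hden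
    _ = C * Real.exp δ / (m * m') * Real.exp (-δ * |u|) := by
        have : δ * (1 + |u|) = δ + -δ * |u| + 2 * δ * |u| := by ring
        rw [this, Real.exp_add, Real.exp_add]
        field_simp

lemma integrable_gcontIntegrand (s : ℂ) {ω ε : ℝ} (hω : 0 < ω) (hε : 0 < ε) (hε1 : ε < 1)
    (hεω : ω * ε < 1) :
    Integrable fun u : ℝ => gcontIntegrand s ω (((-ε : ℝ) : ℂ) + u * I) := by
  obtain ⟨C, c, hc, h⟩ := exists_norm_gcontIntegrand_le s hω hε hε1 hεω
  exact integrable_vertical_of_exp_decay hc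
    (differentiableOn_gcontIntegrand s hω hε hε1 hεω).continuousOn (fun u => by simp)
    (h _ (by simp))

/-- `Gcont s ω ε` does not depend on the admissible abscissa `ε`. -/
lemma Gcont_eq_Gcont_of_lt (s : ℂ) {ω a b : ℝ} (hω : 0 < ω)
    (ha : 0 < a) (ha1 : a < 1) (haω : ω * a < 1) (hb : 0 < b) (hb1 : b < 1) (hbω : ω * b < 1) :
    Gcont s ω a = Gcont s ω b := by
  wlog hab : a ≤ b generalizing a b
  · exact (this hb hb1 hbω ha ha1 haω (le_of_not_ge hab)).symm
  obtain ⟨C, c, hc, h⟩ := exists_norm_gcontIntegrand_le s hω ha hb1 hbω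
  rw [Gcont_eq, Gcont_eq, integral_vertical_eq_of_exp_decay (neg_le_neg hab) hc
    (differentiableOn_gcontIntegrand s hω ha hb1 hbω) h]

lemma one_div_mul_sub_one_eq_add {x y : ℂ} (hx : x ≠ 0) (hy : y ≠ 0) (hx1 : x - 1 ≠ 0)
    (hy1 : y - 1 ≠ 0) (hxy : y * x⁻¹ - 1 ≠ 0) :
    1 / ((x - 1) * (y - 1)) =
      1 / ((x - 1) * (y * x⁻¹ - 1)) + 1 / ((x * y⁻¹ - 1) * (y - 1)) := by
  have h : y - x ≠ 0 := fun h => hxy (by rw [sub_eq_zero.mp h, mul_inv_cancel₀ hx, sub_self])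
  have h1 : y * x⁻¹ - 1 = (y - x) / x := by field_simp
  have h2 : x * y⁻¹ - 1 = -(y - x) / y := by field_simp; ring
  rw [h1, h2]
  field_simp
  ring

/-- Pointwise three-term relation for the integrands. -/
lemma gcontIntegrand_three_term (s : ℂ) {ω : ℝ} (hω : 0 < ω) {t : ℂ} (h0 : t.re < 0)
    (h1 : (ω + 1) * -t.re < 1) :
    gcontIntegrand s ω t = gcontIntegrand s (ω + 1) t +
      ((ω : ℂ) + 1) ^ (1 - s) *
        gcontIntegrand s (ω / (ω + 1)) (((ω + 1 : ℝ) : ℂ) * t) := by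
  have hω1 : (ω : ℂ) + 1 ≠ 0 := by exact_mod_cast (by positivity : ω + 1 ≠ 0)
  have hx1 := exp_two_pi_I_mul_sub_one_ne_zero h0 (by nlinarith)
  have hy1 := exp_neg_two_pi_I_mul_sub_one_ne_zero hω h0 (by nlinarith)
  have hxy := exp_neg_two_pi_I_mul_sub_one_ne_zero (by positivity : 0 < ω + 1) h0 h1
  have e1 : exp (-(2 * Real.pi * I * ((ω + 1 : ℝ) : ℂ) * t)) =
      exp (-(2 * Real.pi * I * ω * t)) * (exp (2 * Real.pi * I * t))⁻¹ := by
    rw [← exp_neg, ← exp_add]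
    congr 1
    push_cast
    ring
  have e2 : exp (2 * Real.pi * I * (((ω + 1 : ℝ) : ℂ) * t)) =
      exp (2 * Real.pi * I * t) * (exp (-(2 * Real.pi * I * ω * t)))⁻¹ := by
    rw [← exp_neg, ← exp_add]
    congr 1
    push_cast
    ring
  have e3 : exp (-(2 * Real.pi * I * ((ω / (ω + 1) : ℝ) : ℂ) * (((ω + 1 : ℝ) : ℂ) * t))) =
      exp (-(2 * Real.pi * I * ω * t)) := by
    congr 1
    push_cast
    field_simp
  have hpow : ((ω : ℂ) + 1) ^ (1 - s) * (-(((ω + 1 : ℝ) : ℂ) * t)) ^ (s - 1) =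
      (-t) ^ (s - 1) := by
    have hre : 0 < (-t).re := by simpa using h0
    have harg : (((ω + 1 : ℝ) : ℂ) * -t) ^ (s - 1) =
        ((ω + 1 : ℝ) : ℂ) ^ (s - 1) * (-t) ^ (s - 1) := by
      have ht : -t ≠ 0 := fun h => by simp [h] at hre
      have hr : ((ω + 1 : ℝ) : ℂ) ≠ 0 := by exact_mod_cast hω1
      rw [cpow_def_of_ne_zero (mul_ne_zero hr ht), cpow_def_of_ne_zero hr,
        cpow_def_of_ne_zero ht, log_ofReal_mul (by positivity) ht, ofReal_log (by positivity),
        add_mul, exp_add]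
    rw [← mul_neg, harg, ← mul_assoc]
    push_cast
    rw [← cpow_add _ _ hω1]
    simp
  rw [e1] at hxy
  have key := one_div_mul_sub_one_eq_add (exp_ne_zero _) (exp_ne_zero _) hx1 hy1 hxy
  unfold gcontIntegrand
  rw [← mul_div_assoc, hpow, e1, e2, e3]
  simp only [div_eq_mul_one_div ((-t) ^ (s - 1))]
  rw [key, mul_add]

theorem Gcont_three_term (s : ℂ) (ω : ℝ) (hω : 0 < ω)
    (ε ε₁ ε₂ : ℝ)
    (hε : 0 < ε) (hε1 : ε < 1) (hεω : ε < 1 / ω)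
    (hε₁ : 0 < ε₁) (hε₁1 : ε₁ < 1) (hε₁ω : ε₁ < 1 / (ω + 1))
    (hε₂ : 0 < ε₂) (hε₂1 : ε₂ < 1) (hε₂ω : ε₂ < 1 / (ω / (ω + 1))) :
    Gcont s ω ε =
      Gcont s (ω + 1) ε₁ +
        ((ω : ℂ) + 1) ^ (-s) * Gcont s (ω / (ω + 1)) ε₂ := by
  have hω1 : 0 < ω + 1 := by positivity
  have hρ : 0 < ω / (ω + 1) := by positivity
  have hω1' : (ω : ℂ) + 1 ≠ 0 := by exact_mod_cast hω1.ne'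
  rw [lt_div_iff₀' hω] at hεω
  rw [lt_div_iff₀' hω1] at hε₁ω
  rw [lt_div_iff₀' hρ] at hε₂ω
  have hscale : ω / (ω + 1) * ((ω + 1) * ε₁) = ω * ε₁ := by field_simp
  have hωε₁ : ω * ε₁ < 1 := by linarith
  rw [Gcont_eq_Gcont_of_lt s hω hε hε1 hεω hε₁ hε₁1 hωε₁,
    Gcont_eq_Gcont_of_lt s hρ hε₂ hε₂1 hε₂ω (mul_pos hω1 hε₁) hε₁ω (hscale ▸ hωε₁)]
  have hsubst : (∫ u : ℝ, gcontIntegrand s (ω / (ω + 1))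
        (((ω + 1 : ℝ) : ℂ) * (((-ε₁ : ℝ) : ℂ) + u * I))) =
      ((ω : ℂ) + 1)⁻¹ * ∫ u : ℝ, gcontIntegrand s (ω / (ω + 1))
        (((-((ω + 1) * ε₁) : ℝ) : ℂ) + u * I) := by
    have := Measure.integral_comp_mul_left (fun u : ℝ => gcontIntegrand s (ω / (ω + 1))
        (((-((ω + 1) * ε₁) : ℝ) : ℂ) + u * I)) (ω + 1)
    rw [abs_of_pos (inv_pos.mpr hω1), real_smul] at this
    push_cast at this ⊢
    rw [← this]
    congr! 3
    ring
  have hint : Integrable fun u : ℝ => gcontIntegrand s (ω / (ω + 1))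
      (((ω + 1 : ℝ) : ℂ) * (((-ε₁ : ℝ) : ℂ) + u * I)) := by
    have := (integrable_gcontIntegrand s hρ (mul_pos hω1 hε₁) hε₁ω
      (hscale ▸ hωε₁)).comp_mul_left' hω1.ne'
    refine this.congr (.of_forall fun u => ?_)
    simp only
    congr 1
    push_cast
    ring
  have hpow : ((ω : ℂ) + 1) ^ (1 - s) * ((ω : ℂ) + 1)⁻¹ = ((ω : ℂ) + 1) ^ (-s) := by
    rw [← cpow_neg_one, ← cpow_add _ _ hω1']
    congr 1
    ring
  rw [Gcont_eq, Gcont_eq, Gcont_eq]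
  have hsplit : ∀ u : ℝ, gcontIntegrand s ω (((-ε₁ : ℝ) : ℂ) + u * I) = _ := fun u =>
    gcontIntegrand_three_term s hω (t := ((-ε₁ : ℝ) : ℂ) + u * I) (by simpa using hε₁)
      (by simpa using hε₁ω)
  simp_rw [hsplit]
  rw [integral_add (integrable_gcontIntegrand s hω1 hε₁ hε₁1 hε₁ω) (hint.const_mul _),
    integral_const_mul, hsubst, ← hpow]
  ring
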